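/- arXiv:1802.07581 — 2 statements merged into one kernel-verified Lean document; each statement's English description precedes it below -/
import Mathlib

section
/- Let X be a Polish, locally compact Hausdorff space, and let k : X × X → ℝ be a bounded continuous symmetric positive semidefinite kernel such that the MMD d_k is a metric on P(X) metrizing weak convergence. Let P, Q be Borel probability measures on X and c ∈ (0,1), and assume 0 < D* < ∞ where D* := inf_{R ∈ P(X)} [ c·D(R‖P) + (1−c)·D(R‖Q) ]. For γ > 0 define D*_γ := inf { c·D(R‖P) + (1−c)·D(S‖Q) : (R,S) ∈ P(X)×P(X), d_k(R,S) ≤ γ }. Then lim_{γ → 0⁺} D*_γ = D*. -/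
open MeasureTheory Filter Topology ENNReal
open scoped Classical

noncomputable section
/-- The Kullback-Leibler divergence `D(P‖Q) ∈ [0,∞]`: it equals `∫ log (dP/dQ) dP` when
`P ≪ Q` (and the integral is well defined), and `+∞` otherwise. -/
def klDiv {X : Type*} [MeasurableSpace X] (P Q : Measure X) : ℝ≥0∞ :=
  if P ≪ Q ∧ Integrable (llr P Q) P then ENNReal.ofReal (∫ x, llr P Q x ∂P) else ⊤
/-- The squared Maximum Mean Discrepancy associated with the kernel `k`. -/
def mmdSq {X : Type*} [MeasurableSpace X] (k : X → X → ℝ) (P Q : Measure X) : ℝ :=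
  (∫ y, ∫ y', k y y' ∂P ∂P) + (∫ x, ∫ x', k x x' ∂Q ∂Q) - 2 * ∫ y, ∫ x, k y x ∂Q ∂P

/-- The Maximum Mean Discrepancy `d_k`, the nonnegative square root of `mmdSq`. -/
def mmd {X : Type*} [MeasurableSpace X] (k : X → X → ℝ) (P Q : Measure X) : ℝ :=
  Real.sqrt (mmdSq k P Q)

section KullbackLeibler

variable {X : Type*} [MeasurableSpace X]

/-- For probability measures, the divergence agrees with Mathlib's. -/
lemma klDiv_eq_mathlib_klDiv (R P : Measure X) [IsProbabilityMeasure R] [IsProbabilityMeasure P] :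
    klDiv R P = InformationTheory.klDiv R P := by
  rw [klDiv, InformationTheory.klDiv_def]
  simp

/-- Young's inequality for the convex conjugate of `klFun`. -/
lemma mul_le_klFun_add_exp_sub_one {x : ℝ} (hx : 0 ≤ x) (y : ℝ) :
    x * y ≤ InformationTheory.klFun x + (Real.exp y - 1) := by
  rw [InformationTheory.klFun_apply]
  rcases hx.eq_or_lt with rfl | hx
  · simp [Real.exp_nonneg]
  · have h := Real.add_one_le_exp (y - Real.log x)
    rw [Real.exp_sub, Real.exp_log hx, le_div_iff₀ hx] at h
    nlinarith

lemma integrable_of_abs_le {μ : Measure X} [IsFiniteMeasure μ] {f : X → ℝ} (hf : Measurable f)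
    {B : ℝ} (hB : ∀ x, |f x| ≤ B) : Integrable f μ :=
  Integrable.of_bound hf.aestronglyMeasurable B (ae_of_all _ hB)

lemma integrable_exp_sub_one_of_abs_le {μ : Measure X} [IsFiniteMeasure μ] {f : X → ℝ}
    (hf : Measurable f) {B : ℝ} (hB : ∀ x, |f x| ≤ B) :
    Integrable (fun x => Real.exp (f x) - 1) μ := by
  refine Integrable.sub ?_ (integrable_const 1)
  refine integrable_of_abs_le (B := Real.exp B) (by fun_prop) fun x => ?_
  rw [abs_of_nonneg (Real.exp_nonneg _)]
  exact Real.exp_le_exp.2 (abs_le.1 (hB x)).2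

/-- The easy half of the variational formula for the Kullback-Leibler divergence. -/
lemma integral_le_of_klDiv_le {R P : Measure X} [IsProbabilityMeasure R] [IsProbabilityMeasure P]
    {M : ℝ} (hM : 0 ≤ M) (h : klDiv R P ≤ ENNReal.ofReal M) {f : X → ℝ} (hf : Measurable f)
    {B : ℝ} (hB : ∀ x, |f x| ≤ B) :
    ∫ x, f x ∂ R ≤ M + ∫ x, (Real.exp (f x) - 1) ∂P := by
  rw [klDiv_eq_mathlib_klDiv] at h
  obtain ⟨hac, h_int⟩ := InformationTheory.klDiv_ne_top_iff.1 (h.trans_lt ofReal_lt_top).ne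
  have hreal := ENNReal.toReal_le_of_le_ofReal hM h
  rw [InformationTheory.toReal_klDiv_eq_integral_klFun hac] at hreal
  have hkl := (InformationTheory.integrable_klFun_rnDeriv_iff hac).2 h_int
  have hexp := integrable_exp_sub_one_of_abs_le (μ := P) hf hB
  calc ∫ x, f x ∂ R = ∫ x, (R.rnDeriv P x).toReal • f x ∂P := (integral_rnDeriv_smul hac).symm
    _ ≤ ∫ x, (InformationTheory.klFun (R.rnDeriv P x).toReal + (Real.exp (f x) - 1)) ∂P := by
        refine integral_mono ?_ (hkl.add hexp)
          fun x => mul_le_klFun_add_exp_sub_one ENNReal.toReal_nonneg _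
        exact (integrable_rnDeriv_smul_iff hac).2 (integrable_of_abs_le hf hB)
    _ ≤ _ := by
        rw [integral_add hkl hexp]
        linarith

/-- Exponential change-of-measure bound obtained by testing against a multiple of an indicator. -/
lemma mul_measureReal_le {R P : Measure X} [IsProbabilityMeasure R] [IsProbabilityMeasure P]
    {M : ℝ} (h : ∀ (f : X → ℝ) (B : ℝ), Measurable f → (∀ x, |f x| ≤ B) →
      ∫ x, f x ∂ R ≤ M + ∫ x, (Real.exp (f x) - 1) ∂P)
    {A : Set X} (hA : MeasurableSet A) {t : ℝ} (ht : 0 ≤ t) :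
    t * R.real A ≤ M + (Real.exp t - 1) * P.real A := by
  have key := h (A.indicator fun _ => t) t (measurable_const.indicator hA) fun x => by
    by_cases hx : x ∈ A <;> simp [hx, ht, abs_of_nonneg]
  have hexp : (fun x => Real.exp (A.indicator (fun _ => t) x) - 1)
      = A.indicator fun _ => Real.exp t - 1 := by
    ext x
    by_cases hx : x ∈ A <;> simp [hx]
  rw [hexp, integral_indicator_const _ hA, integral_indicator_const _ hA] at key
  simpa [mul_comm] using key

lemma integral_le_of_forall_boundedContinuous [TopologicalSpace X] [BorelSpace X]
    [TopologicalSpace.PseudoMetrizableSpace X]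
    {R P : Measure X} [IsProbabilityMeasure R] [IsProbabilityMeasure P] {M : ℝ}
    (h : ∀ f : BoundedContinuousFunction X ℝ,
      ∫ x, f x ∂ R ≤ M + ∫ x, (Real.exp (f x) - 1) ∂P)
    {f : X → ℝ} (hf : Measurable f) {B : ℝ} (hB : ∀ x, |f x| ≤ B) :
    ∫ x, f x ∂ R ≤ M + ∫ x, (Real.exp (f x) - 1) ∂P := by
  let _ := TopologicalSpace.pseudoMetrizableSpacePseudoMetric X
  refine le_of_forall_pos_le_add fun ε hε => ?_
  have hE : 0 < 1 + Real.exp B := by positivity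
  obtain ⟨g, hg, -⟩ := (integrable_of_abs_le (μ := R + P) hf hB
    ).exists_boundedContinuous_integral_sub_le (div_pos hε hE)
  have hfR := integrable_of_abs_le (μ := R) hf hB
  have hfP := integrable_of_abs_le (μ := P) hf hB
  have hgR : Integrable g R := g.integrable R
  have hgP : Integrable g P := g.integrable P
  have hnR : Integrable (fun x => ‖f x - g x‖) R := (hfR.sub hgR).norm
  have hnP : Integrable (fun x => ‖f x - g x‖) P := (hfP.sub hgP).norm
  rw [integral_add_measure hnR hnP] at hg
  let g' : BoundedContinuousFunction X ℝ :=
    BoundedContinuousFunction.ofNormedAddCommGroup (fun x => max (-B) (min (g x) B))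
      (by fun_prop) |B| fun x => by
        have hB0 : 0 ≤ B := (abs_nonneg _).trans (hB x)
        rw [Real.norm_eq_abs, abs_of_nonneg hB0, abs_le]
        exact ⟨le_max_left _ _, max_le (by linarith) (min_le_right _ _)⟩
  have hg'B : ∀ x, |g' x| ≤ B := fun x => by
    have hB0 : 0 ≤ B := (abs_nonneg _).trans (hB x)
    exact abs_le.2 ⟨le_max_left _ _, max_le (by linarith) (min_le_right _ _)⟩
  have hclose : ∀ x, |f x - g' x| ≤ ‖f x - g x‖ := fun x => by
    obtain ⟨h1, h2⟩ := abs_le.1 (hB x)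
    change |f x - max (-B) (min (g x) B)| ≤ |f x - g x|
    rcases max_cases (-B) (min (g x) B) with ⟨h3, h4⟩ | ⟨h3, h4⟩ <;>
    rcases min_cases (g x) B with ⟨h5, h6⟩ | ⟨h5, h6⟩ <;>
    rw [h3] <;> try rw [h5]
    all_goals
      rcases abs_cases (f x - g x) with ⟨h7, h8⟩ | ⟨h7, h8⟩ <;> rw [h7, abs_le] <;>
        constructor <;> linarith
  have hg'm : Measurable g' := g'.continuous.measurable
  have hR : ∫ x, f x ∂ R ≤ ∫ x, g' x ∂ R + ∫ x, ‖f x - g x‖ ∂ R := by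
    rw [← integral_add (g'.integrable R) hnR]
    refine integral_mono hfR ((g'.integrable R).add hnR) fun x => ?_
    have := (le_abs_self _).trans (hclose x)
    change f x ≤ g' x + ‖f x - g x‖
    linarith
  have hexpf := integrable_exp_sub_one_of_abs_le (μ := P) hf hB
  have hexpg := integrable_exp_sub_one_of_abs_le (μ := P) hg'm hg'B
  have hP : ∫ x, (Real.exp (g' x) - 1) ∂P
      ≤ ∫ x, (Real.exp (f x) - 1) ∂P + Real.exp B * ∫ x, ‖f x - g x‖ ∂P := by
    rw [← integral_const_mul, ← integral_add hexpf (hnP.const_mul _)]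
    refine integral_mono hexpg (hexpf.add (hnP.const_mul _)) fun x => ?_
    change Real.exp (g' x) - 1 ≤ Real.exp (f x) - 1 + Real.exp B * ‖f x - g x‖
    have h1 := Real.add_one_le_exp (f x - g' x)
    have h2 : Real.exp (f x) = Real.exp (g' x) * Real.exp (f x - g' x) := by
      rw [← Real.exp_add]; ring_nf
    have h3 : Real.exp (g' x) ≤ Real.exp B := Real.exp_le_exp.2 (abs_le.1 (hg'B x)).2
    have h4 := (neg_le_abs _).trans (hclose x)
    have h5 := Real.exp_pos (g' x)
    have h6 : Real.exp (g' x) * ‖f x - g x‖ ≤ Real.exp B * ‖f x - g x‖ := by gcongr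
    nlinarith
  have hR0 : 0 ≤ ∫ x, ‖f x - g x‖ ∂ R := integral_nonneg fun _ => norm_nonneg _
  have hP0 : 0 ≤ ∫ x, ‖f x - g x‖ ∂P := integral_nonneg fun _ => norm_nonneg _
  rw [le_div_iff₀ hE] at hg
  have := h g'
  nlinarith [Real.exp_pos B]

/-- The hard half of the variational formula for the Kullback-Leibler divergence, with bounded
measurable test functions. -/
lemma klDiv_le_of_forall_integral_le
    {R P : Measure X} [IsProbabilityMeasure R] [IsProbabilityMeasure P] {M : ℝ}
    (h : ∀ (f : X → ℝ) (B : ℝ), Measurable f → (∀ x, |f x| ≤ B) →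
      ∫ x, f x ∂ R ≤ M + ∫ x, (Real.exp (f x) - 1) ∂P) :
    klDiv R P ≤ ENNReal.ofReal M := by
  have hac : R ≪ P := by
    refine Measure.AbsolutelyContinuous.mk fun A hA hPA => ?_
    by_contra hRA
    have hpos : 0 < R.real A := ENNReal.toReal_pos hRA (measure_ne_top _ _)
    have h1 := mul_measureReal_le h hA (t := (|M| + 1) / R.real A) (by positivity)
    rw [div_mul_cancel₀ _ hpos.ne', measureReal_def P, hPA] at h1
    simp only [toReal_zero, mul_zero, add_zero] at h1
    linarith [le_abs_self M]
  rw [klDiv_eq_mathlib_klDiv, InformationTheory.klDiv_eq_lintegral_klFun_of_ac hac]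
  set g : X → ℝ := fun x => (R.rnDeriv P x).toReal
  have hgm : Measurable g := by fun_prop
  have hg0 : ∀ x, 0 ≤ g x := fun x => ENNReal.toReal_nonneg
  let a : ℕ → ℝ := fun n => n + 1
  have ha : ∀ n, 1 ≤ a n := fun n => by simp [a]
  let u : ℕ → X → ℝ := fun n x => max (a n)⁻¹ (min (g x) (a n))
  have hu : ∀ n x, (a n)⁻¹ ≤ u n x := fun n x => le_max_left _ _
  have hu0 : ∀ n x, 0 < u n x := fun n x => (by have := ha n; positivity : 0 < (a n)⁻¹).trans_le
    (hu n x)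
  have hu' : ∀ n x, u n x ≤ a n := fun n x =>
    max_le ((inv_le_one_of_one_le₀ (ha n)).trans (ha n)) (min_le_right _ _)
  have hum : ∀ n, Measurable (u n) := fun n => by fun_prop
  let F : ℕ → X → ℝ := fun n x => g x * Real.log (u n x) - (u n x - 1)
  have hlogB : ∀ n x, |Real.log (u n x)| ≤ Real.log (a n) := fun n x => by
    rw [abs_le, ← Real.log_inv]
    exact ⟨Real.log_le_log (by have := ha n; positivity) (hu n x),
      Real.log_le_log (hu0 n x) (hu' n x)⟩
  have hlogm : ∀ n, Measurable fun x => Real.log (u n x) := fun n => (hum n).log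
  have hF0 : ∀ n x, 0 ≤ F n x := fun n x => by
    have hk := InformationTheory.klFun_nonneg (hu0 n x).le
    rw [InformationTheory.klFun_apply] at hk
    have hmono : u n x * Real.log (u n x) ≤ g x * Real.log (u n x) := by
      have ha1 := ha n
      have hai : (a n)⁻¹ ≤ 1 := inv_le_one_of_one_le₀ ha1
      rcases le_total (g x) (a n) with h1 | h1
      · rcases le_total (g x) (a n)⁻¹ with h2 | h2
        · have hux : u n x = (a n)⁻¹ := by simp [u, min_eq_left h1, max_eq_left h2]
          have : Real.log (u n x) ≤ 0 := by
            rw [hux]; exact Real.log_nonpos (by positivity) hai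
          exact mul_le_mul_of_nonpos_right (hux ▸ h2) this
        · have hux : u n x = g x := by simp [u, min_eq_left h1, max_eq_right h2]
          rw [hux]
      · have hux : u n x = a n := by simp [u, min_eq_right h1, max_eq_right (hai.trans ha1)]
        have : 0 ≤ Real.log (u n x) := by rw [hux]; exact Real.log_nonneg ha1
        exact mul_le_mul_of_nonneg_right (hux ▸ h1) this
    change 0 ≤ g x * Real.log (u n x) - (u n x - 1)
    linarith
  have hFm : ∀ n, Measurable (F n) := fun n =>
    (hgm.mul (hlogm n)).sub ((hum n).sub measurable_const)
  have hFint : ∀ n, ∫⁻ x, ENNReal.ofReal (F n x) ∂P ≤ ENNReal.ofReal M := fun n => by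
    have hi1 : Integrable (fun x => g x * Real.log (u n x)) P :=
      (integrable_rnDeriv_smul_iff hac).2 (integrable_of_abs_le (hlogm n) (hlogB n))
    have hi2 : Integrable (fun x => u n x - 1) P := by
      refine (integrable_of_abs_le (hum n) (B := a n) fun x => ?_).sub (integrable_const 1)
      rw [abs_of_pos (hu0 n x)]
      exact hu' n x
    have hFi : Integrable (F n) P := hi1.sub hi2
    rw [← ofReal_integral_eq_lintegral_ofReal hFi (ae_of_all _ (hF0 n))]
    refine ENNReal.ofReal_le_ofReal ?_
    have key := h (fun x => Real.log (u n x)) _ (hlogm n) (hlogB n)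
    simp only [Real.exp_log (hu0 n _)] at key
    rw [← integral_rnDeriv_smul hac] at key
    change ∫ x, (g x * Real.log (u n x) - (u n x - 1)) ∂P ≤ M
    rw [integral_sub hi1 hi2]
    change ∫ x, g x * Real.log (u n x) ∂P ≤ _ at key
    linarith
  have ha_top : Tendsto a atTop atTop :=
    tendsto_atTop_add_const_right _ _ tendsto_natCast_atTop_atTop
  have hlim : ∀ x, Tendsto (fun n => F n x) atTop (𝓝 (InformationTheory.klFun (g x))) := by
    intro x
    have hut : Tendsto (fun n => u n x) atTop (𝓝 (g x)) := by
      have h1 : Tendsto (fun n => max (a n)⁻¹ (g x)) atTop (𝓝 (max 0 (g x))) :=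
        (tendsto_inv_atTop_zero.comp ha_top).max tendsto_const_nhds
      rw [max_eq_right (hg0 x)] at h1
      refine h1.congr' ?_
      filter_upwards [ha_top.eventually_ge_atTop (g x)] with n hn
      simp [u, min_eq_left hn]
    have hfirst : Tendsto (fun n => g x * Real.log (u n x)) atTop
        (𝓝 (g x * Real.log (g x))) := by
      rcases (hg0 x).eq_or_lt with h0 | h0
      · simp [← h0]
      · exact (hut.log h0.ne').const_mul _
    rw [InformationTheory.klFun_apply, add_sub_assoc,
      show g x * Real.log (g x) + (1 - g x) = g x * Real.log (g x) - (g x - 1) by ring]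
    exact hfirst.sub (hut.sub_const 1)
  calc ∫⁻ x, ENNReal.ofReal (InformationTheory.klFun (g x)) ∂P
      = ∫⁻ x, liminf (fun n => ENNReal.ofReal (F n x)) atTop ∂P := by
        refine lintegral_congr fun x => ?_
        exact ((ENNReal.tendsto_ofReal (hlim x)).liminf_eq).symm
    _ ≤ liminf (fun n => ∫⁻ x, ENNReal.ofReal (F n x) ∂P) atTop :=
        lintegral_liminf_le fun n => (hFm n).ennreal_ofReal
    _ ≤ ENNReal.ofReal M := by
        refine liminf_le_of_frequently_le' (Frequently.of_forall hFint)

/-- The Kullback-Leibler divergence is weakly lower semicontinuous in its first argument. -/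
lemma lowerSemicontinuous_klDiv_left [TopologicalSpace X] [BorelSpace X]
    [TopologicalSpace.PseudoMetrizableSpace X] (P : ProbabilityMeasure X) :
    LowerSemicontinuous fun R : ProbabilityMeasure X => klDiv (R : Measure X) (P : Measure X) := by
  rw [lowerSemicontinuous_iff_isClosed_preimage]
  intro y
  rcases eq_or_ne y ⊤ with rfl | hy
  · simp
  have hset : (fun R : ProbabilityMeasure X => klDiv (R : Measure X) (P : Measure X)) ⁻¹' Set.Iic y
      = ⋂ f : BoundedContinuousFunction X ℝ, {R : ProbabilityMeasure X |
        ∫ x, f x ∂(R : Measure X)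
          ≤ y.toReal + ∫ x, (Real.exp (f x) - 1) ∂(P : Measure X)} := by
    ext R
    simp only [Set.mem_preimage, Set.mem_Iic, Set.mem_iInter, Set.mem_ofPred_eq]
    rw [← ENNReal.ofReal_toReal hy, ENNReal.toReal_ofReal ENNReal.toReal_nonneg]
    exact ⟨fun h f => integral_le_of_klDiv_le toReal_nonneg h f.continuous.measurable
        f.norm_coe_le_norm,
      fun h => klDiv_le_of_forall_integral_le fun _ _ hf hB =>
        integral_le_of_forall_boundedContinuous h hf hB⟩
  rw [hset]
  exact isClosed_iInter fun f => isClosed_le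
    (ProbabilityMeasure.continuous_integral_boundedContinuousFunction f) continuous_const

/-- Sublevel sets of the Kullback-Leibler divergence are weakly compact. -/
lemma isCompact_setOf_klDiv_le [TopologicalSpace X] [PolishSpace X] [BorelSpace X]
    (P : ProbabilityMeasure X) {y : ℝ≥0∞} (hy : y ≠ ⊤) :
    IsCompact {R : ProbabilityMeasure X | klDiv (R : Measure X) (P : Measure X) ≤ y} := by
  have hclosed : IsClosed {R : ProbabilityMeasure X | klDiv (R : Measure X) (P : Measure X) ≤ y} :=
    (lowerSemicontinuous_klDiv_left P).isClosed_preimage y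
  rw [← IsClosed.closure_eq hclosed]
  apply isCompact_closure_of_isTightMeasureSet
  rw [isTightMeasureSet_iff_exists_isCompact_measure_compl_le]
  intro ε hε
  rcases eq_or_ne ε ⊤ with rfl | hε'
  · exact ⟨∅, isCompact_empty, by simp⟩
  have he : 0 < ε.toReal := ENNReal.toReal_pos hε.ne' hε'
  have hM : 0 ≤ y.toReal := toReal_nonneg
  set t := (y.toReal + 1) / ε.toReal with ht
  have ht0 : 0 < t := by positivity
  obtain ⟨K, hK, hPK⟩ := (isTightMeasureSet_iff_exists_isCompact_measure_compl_le.1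
    (isTightMeasureSet_singleton (μ := (P : Measure X)))) (ENNReal.ofReal (Real.exp (-t)))
    (by simp [Real.exp_pos])
  refine ⟨K, hK, ?_⟩
  rintro _ ⟨R, hR, rfl⟩
  have hR' : klDiv (R : Measure X) (P : Measure X) ≤ ENNReal.ofReal y.toReal := by
    rw [ENNReal.ofReal_toReal hy]; exact hR
  have hb := mul_measureReal_le (R := (R : Measure X)) (P := (P : Measure X))
    (fun f B hf hB => integral_le_of_klDiv_le toReal_nonneg hR' hf hB)
    hK.isClosed.measurableSet.compl ht0.le
  have hP : (P : Measure X).real Kᶜ ≤ Real.exp (-t) :=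
    ENNReal.toReal_le_of_le_ofReal (Real.exp_nonneg _) (hPK _ rfl)
  have h1 : (Real.exp t - 1) * (P : Measure X).real Kᶜ ≤ 1 := by
    have h2 : Real.exp t * Real.exp (-t) = 1 := by rw [← Real.exp_add]; simp
    have h3 : Real.exp t * (P : Measure X).real Kᶜ ≤ Real.exp t * Real.exp (-t) := by gcongr
    have h4 : 0 ≤ (P : Measure X).real Kᶜ := measureReal_nonneg
    linarith
  have h5 : (R : Measure X).real Kᶜ ≤ ε.toReal := by
    have h6 : t * (R : Measure X).real Kᶜ ≤ t * ε.toReal := by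
      rw [ht, div_mul_cancel₀ _ he.ne']; linarith
    exact le_of_mul_le_mul_left h6 ht0
  exact (ENNReal.toReal_le_toReal (measure_ne_top _ _) hε').1 h5

end KullbackLeibler

/-- The MMD of a bounded continuous symmetric kernel is symmetric. -/
lemma mmd_comm {X : Type*} [MeasurableSpace X] [TopologicalSpace X] [SecondCountableTopology X]
    [OpensMeasurableSpace X] {k : X → X → ℝ} (hk_cont : Continuous fun p : X × X => k p.1 p.2)
    (hk_bdd : ∃ C : ℝ, ∀ x y, |k x y| ≤ C) (hk_symm : ∀ x y, k x y = k y x)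
    (R S : ProbabilityMeasure X) :
    mmd k (R : Measure X) (S : Measure X) = mmd k (S : Measure X) (R : Measure X) := by
  obtain ⟨C, hC⟩ := hk_bdd
  have hswap : ∫ y, ∫ x, k y x ∂(S : Measure X) ∂(R : Measure X)
      = ∫ y, ∫ x, k y x ∂(R : Measure X) ∂(S : Measure X) := by
    rw [integral_integral_swap]
    · simp only [hk_symm]
    · exact integrable_of_abs_le hk_cont.measurable fun p => hC p.1 p.2
  rw [mmd, mmd, mmdSq, mmdSq, hswap, add_comm (∫ y, ∫ y', k y y' ∂(R : Measure X) ∂(R : Measure X))]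

/-- Let `D* = inf_R [c D(R‖P) + (1-c) D(R‖Q)]` and, for `γ > 0`,
`D*_γ = inf {c D(R‖P) + (1-c) D(S‖Q) : d_k(R,S) ≤ γ}`, where the MMD `d_k` is a metric on
the probability measures metrizing weak convergence. If `0 < D* < ∞`, then
`D*_γ → D*` as `γ → 0⁺`. -/
theorem Dstar_gamma_tendsto_Dstar {X : Type*} [MeasurableSpace X] [TopologicalSpace X]
    [PolishSpace X] [LocallyCompactSpace X] [T2Space X] [BorelSpace X]
    (k : X → X → ℝ) (hk_cont : Continuous fun p : X × X => k p.1 p.2)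
    (hk_bdd : ∃ C : ℝ, ∀ x y, |k x y| ≤ C)
    (hk_symm : ∀ x y, k x y = k y x)
    (hk_psd : ∀ (N : ℕ) (z : Fin N → X) (cv : Fin N → ℝ),
      0 ≤ ∑ i, ∑ j, cv i * cv j * k (z i) (z j))
    (h_sep : ∀ R S : ProbabilityMeasure X,
      mmd k (R : Measure X) (S : Measure X) = 0 ↔ R = S)
    (h_tri : ∀ R S T : ProbabilityMeasure X,
      mmd k (R : Measure X) (T : Measure X)
        ≤ mmd k (R : Measure X) (S : Measure X) + mmd k (S : Measure X) (T : Measure X))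
    (h_metrize : ∀ s : Set (ProbabilityMeasure X),
      IsOpen s ↔ ∀ R ∈ s, ∃ ε > 0,
        ∀ S : ProbabilityMeasure X, mmd k (S : Measure X) (R : Measure X) < ε → S ∈ s)
    (P Q : ProbabilityMeasure X) (c : ℝ) (hc0 : 0 < c) (hc1 : c < 1)
    (hD0 : 0 < ⨅ R : ProbabilityMeasure X,
      ENNReal.ofReal c * klDiv (R : Measure X) (P : Measure X)
        + ENNReal.ofReal (1 - c) * klDiv (R : Measure X) (Q : Measure X))
    (hD1 : (⨅ R : ProbabilityMeasure X,
      ENNReal.ofReal c * klDiv (R : Measure X) (P : Measure X)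
        + ENNReal.ofReal (1 - c) * klDiv (R : Measure X) (Q : Measure X)) < ⊤) :
    Tendsto (fun γ : ℝ =>
        ⨅ (RS : ProbabilityMeasure X × ProbabilityMeasure X)
          (_ : mmd k (RS.1 : Measure X) (RS.2 : Measure X) ≤ γ),
          ENNReal.ofReal c * klDiv (RS.1 : Measure X) (P : Measure X)
            + ENNReal.ofReal (1 - c) * klDiv (RS.2 : Measure X) (Q : Measure X))
      (𝓝[>] 0)
      (𝓝 (⨅ R : ProbabilityMeasure X,
        ENNReal.ofReal c * klDiv (R : Measure X) (P : Measure X)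
          + ENNReal.ofReal (1 - c) * klDiv (R : Measure X) (Q : Measure X))) := by
  have h_zero : ∀ R : ProbabilityMeasure X, mmd k (R : Measure X) (R : Measure X) = 0 :=
    fun R => (h_sep R R).2 rfl
  have h_ball : ∀ (R : ProbabilityMeasure X) {ε : ℝ}, 0 < ε →
      {S : ProbabilityMeasure X | mmd k (S : Measure X) (R : Measure X) < ε} ∈ 𝓝 R := by
    intro R ε hε
    refine IsOpen.mem_nhds ((h_metrize _).2 fun T hT => ?_) (by simpa [h_zero R] using hε)
    refine ⟨ε - mmd k (T : Measure X) (R : Measure X), sub_pos.2 hT, fun S hS => ?_⟩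
    have := h_tri S T R
    change mmd k (S : Measure X) (R : Measure X) < ε
    linarith
  set F : ProbabilityMeasure X × ProbabilityMeasure X → ℝ≥0∞ := fun RS =>
    ENNReal.ofReal c * klDiv (RS.1 : Measure X) (P : Measure X)
      + ENNReal.ofReal (1 - c) * klDiv (RS.2 : Measure X) (Q : Measure X)
  have hc : ENNReal.ofReal c ≠ 0 := by simpa using hc0
  have hc' : ENNReal.ofReal (1 - c) ≠ 0 := by simpa using hc1
  have hF_lsc : LowerSemicontinuous F := by
    have h1 : ∀ a : ℝ, Continuous fun y : ℝ≥0∞ => ENNReal.ofReal a * y := fun a =>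
      ENNReal.continuous_const_mul ofReal_ne_top
    refine LowerSemicontinuous.add ?_ ?_
    · exact (h1 c).comp_lowerSemicontinuous
        ((lowerSemicontinuous_klDiv_left P).comp continuous_fst) fun _ _ h => mul_le_mul_right h _
    · exact (h1 (1 - c)).comp_lowerSemicontinuous
        ((lowerSemicontinuous_klDiv_left Q).comp continuous_snd) fun _ _ h => mul_le_mul_right h _
  have hF_compact : ∀ b : ℝ≥0∞, b ≠ ⊤ → IsCompact {RS | F RS ≤ b} := fun b hb => by
    refine ((isCompact_setOf_klDiv_le P (ENNReal.div_ne_top hb hc)).prod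
      (isCompact_setOf_klDiv_le Q (ENNReal.div_ne_top hb hc'))).of_isClosed_subset
      (hF_lsc.isClosed_preimage b) ?_
    intro RS hRS
    constructor
    · change _ ≤ b / _
      rw [ENNReal.le_div_iff_mul_le (Or.inl hc) (Or.inl ofReal_ne_top), mul_comm]
      exact le_self_add.trans hRS
    · change _ ≤ b / _
      rw [ENNReal.le_div_iff_mul_le (Or.inl hc') (Or.inl ofReal_ne_top), mul_comm]
      exact le_add_self.trans hRS
  refine tendsto_order.2 ⟨fun a ha => ?_, fun a ha => ?_⟩
  · obtain ⟨b, hab, hb⟩ := exists_between ha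
    by_contra hcon
    have hex : ∀ γ : ℝ, 0 < γ → ∃ RS : ProbabilityMeasure X × ProbabilityMeasure X,
        mmd k (RS.1 : Measure X) (RS.2 : Measure X) ≤ γ ∧ F RS ≤ b := by
      intro γ hγ
      obtain ⟨δ, hδ, hδγ⟩ := ((not_eventually.1 hcon).and_eventually
        (Ioo_mem_nhdsGT hγ)).exists
      obtain ⟨RS, hRS⟩ := iInf_lt_iff.1 ((not_lt.1 hδ).trans_lt hab)
      obtain ⟨hd, hlt⟩ := iInf_lt_iff.1 hRS
      exact ⟨RS, hd.trans hδγ.2.le, hlt.le⟩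
    have : Nonempty (ProbabilityMeasure X × ProbabilityMeasure X) := ⟨(P, Q)⟩
    choose! u hu_mmd hu_F using hex
    obtain ⟨⟨R, S⟩, hRS, hcl⟩ := (hF_compact b (hb.trans hD1).ne).exists_mapClusterPt
      (f := 𝓝[>] (0 : ℝ)) (u := u)
      (le_principal_iff.2 (mem_map.2 (mem_of_superset self_mem_nhdsWithin hu_F)))
    have hle : ∀ ε : ℝ, 0 < ε → mmd k (R : Measure X) (S : Measure X) ≤ 0 + ε := by
      intro ε hε
      have hε3 : 0 < ε / 3 := by positivity
      obtain ⟨γ, hγ, hγε⟩ := ((mapClusterPt_iff_frequently.1 hcl _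
        (prod_mem_nhds (h_ball R hε3) (h_ball S hε3))).and_eventually
        (Ioo_mem_nhdsGT hε3)).exists
      have h1 : mmd k ((u γ).1 : Measure X) (R : Measure X) < ε / 3 := hγ.1
      have h2 : mmd k ((u γ).2 : Measure X) (S : Measure X) < ε / 3 := hγ.2
      rw [mmd_comm hk_cont hk_bdd hk_symm] at h1
      linarith [h_tri R (u γ).1 S, h_tri (u γ).1 (u γ).2 S, hu_mmd γ hγε.1, hγε.2]
    have hRS_eq : R = S :=
      (h_sep R S).1 (le_antisymm (le_of_forall_pos_le_add hle) (Real.sqrt_nonneg _))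
    subst hRS_eq
    exact (hb.trans_le (iInf_le _ R)).not_ge hRS
  · filter_upwards [self_mem_nhdsWithin] with γ hγ
    refine lt_of_le_of_lt (le_iInf fun R => ?_) ha
    exact iInf₂_le_of_le (R, R) ((h_zero R).trans_le (le_of_lt hγ)) le_rfl
end
end

section
/- Let X be a Polish space and let d be any metric on P(X) that metrizes the topology of weak convergence. Let P, Q be Borel probability measures on X with 0 < D(P‖Q) < ∞, let x_1, x_2, … be i.i.d. with law Q, with empirical measures Q̂_n, and let (γ_n) be any sequence of positive reals with γ_n → 0. Then liminf_{n→∞} −(1/n) log Prob( d(P, Q̂_n) ≤ γ_n ) ≥ D(P‖Q). -/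
open MeasureTheory Filter Topology ENNReal
open scoped Classical

noncomputable section
/-- The empirical measure `(1/n) ∑_{i<n} δ_{x i}` of a sample, as a probability measure
(junk value for `n = 0`). -/
def empMeas {X : Type*} [MeasurableSpace X] [Nonempty X] (n : ℕ) (x : Fin n → X) :
    ProbabilityMeasure X :=
  if h : 0 < n then
    ⟨(n : ℝ≥0∞)⁻¹ • ∑ i, Measure.dirac (x i), by
      constructor
      simp only [Measure.smul_apply, smul_eq_mul, Measure.coe_finset_sum, Finset.sum_apply,
        measure_univ, Finset.sum_const, Finset.card_univ, Fintype.card_fin, nsmul_eq_mul, mul_one]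
      exact ENNReal.inv_mul_cancel (by exact_mod_cast h.ne') (by simp)⟩
  else ⟨Measure.dirac (Classical.arbitrary X), inferInstance⟩
/-- The exponential decay rate `-(1/n) log p` of a probability `p`, valued in `EReal`
(with `-(1/n) log 0 = ⊤`). -/
def expRate (n : ℕ) (p : ℝ≥0∞) : EReal := -((((n : ℝ)⁻¹ : ℝ) : EReal) * ENNReal.log p)

lemma Real.abs_log_sub_log_le {m a b : ℝ} (hm : 0 < m) (ha : m ≤ a) (hb : m ≤ b) :
    |Real.log a - Real.log b| ≤ m⁻¹ * |a - b| := by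
  have key : ∀ {s t : ℝ}, m ≤ s → s ≤ t → Real.log t - Real.log s ≤ m⁻¹ * (t - s) := by
    intro s t hs hst
    have hs0 : 0 < s := hm.trans_le hs
    have ht0 : 0 < t := hs0.trans_le hst
    rw [← Real.log_div ht0.ne' hs0.ne']
    calc Real.log (t / s) ≤ t / s - 1 := Real.log_le_sub_one_of_pos (by positivity)
      _ = s⁻¹ * (t - s) := by field_simp
      _ ≤ m⁻¹ * (t - s) := by
        have := sub_nonneg.2 hst
        gcongr
  rcases le_total a b with h | h
  · rw [abs_sub_comm, abs_sub_comm a, abs_of_nonneg (sub_nonneg.2 h),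
      abs_of_nonneg (sub_nonneg.2 (Real.log_le_log (hm.trans_le ha) h))]
    exact key ha h
  · rw [abs_of_nonneg (sub_nonneg.2 h),
      abs_of_nonneg (sub_nonneg.2 (Real.log_le_log (hm.trans_le hb) h))]
    exact key hb h

lemma Real.abs_log_max_min_le {a b r : ℝ} (ha : 0 < a) (ha1 : a ≤ 1) (hb1 : 1 ≤ b) (hr : 0 < r) :
    |Real.log (max a (min b r))| ≤ |Real.log r| := by
  rcases le_total r 1 with h | h
  · have hr' : min b r = r := min_eq_right (h.trans hb1)
    rw [hr', abs_of_nonpos (Real.log_nonpos (by positivity) (max_le ha1 h)),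
      abs_of_nonpos (Real.log_nonpos hr.le h)]
    exact neg_le_neg (Real.log_le_log hr (le_max_right _ _))
  · have h1 : 1 ≤ min b r := le_min hb1 h
    rw [max_eq_right (ha1.trans h1), abs_of_nonneg (Real.log_nonneg h1),
      abs_of_nonneg (Real.log_nonneg h)]
    exact Real.log_le_log (by positivity) (min_le_right _ _)

lemma tendsto_max_inv_min_natCast {r : ℝ} (hr : 0 ≤ r) :
    Tendsto (fun k : ℕ => max ((k : ℝ) + 1)⁻¹ (min ((k : ℝ) + 1) r)) atTop (𝓝 r) := by
  have h1 : Tendsto (fun k : ℕ => ((k : ℝ) + 1)⁻¹) atTop (𝓝 0) := by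
    simpa only [one_div] using tendsto_one_div_add_atTop_nhds_zero_nat (𝕜 := ℝ)
  have h2 : Tendsto (fun k : ℕ => min ((k : ℝ) + 1) r) atTop (𝓝 r) := by
    refine tendsto_const_nhds.congr' ?_
    filter_upwards [eventually_ge_atTop ⌈r⌉₊] with k hk
    have : r ≤ k := (Nat.le_ceil r).trans (by exact_mod_cast hk)
    rw [min_eq_right (by linarith)]
  simpa [max_eq_right hr] using h1.max h2

/-- Truncated densities nearly attain the Donsker-Varadhan supremum. -/
lemma exists_measurable_lt_integral_log_sub_log_integral {X : Type*} [MeasurableSpace X]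
    {P Q : Measure X} [IsProbabilityMeasure P] [IsProbabilityMeasure Q] (hac : P ≪ Q)
    (hint : Integrable (llr P Q) P) {c : ℝ} (hc : c < ∫ x, llr P Q x ∂P) :
    ∃ (u : X → ℝ) (m b : ℝ), 0 < m ∧ Measurable u ∧ (∀ x, m ≤ u x) ∧ (∀ x, u x ≤ b) ∧
      c < ∫ x, Real.log (u x) ∂P - Real.log (∫ x, u x ∂Q) := by
  set r : X → ℝ := fun x => (P.rnDeriv Q x).toReal with hr
  have hr0 : ∀ x, 0 ≤ r x := fun x => ENNReal.toReal_nonneg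
  have hrm : Measurable r := (Measure.measurable_rnDeriv P Q).ennreal_toReal
  have hrpos : ∀ᵐ x ∂P, 0 < r x := by
    filter_upwards [Measure.rnDeriv_pos hac, hac.ae_le (Measure.rnDeriv_lt_top P Q)] with x h1 h2
    exact ENNReal.toReal_pos h1.ne' h2.ne
  set u : ℕ → X → ℝ := fun k x => max ((k : ℝ) + 1)⁻¹ (min ((k : ℝ) + 1) (r x)) with hu
  have hum : ∀ k, Measurable (u k) := fun k => by fun_prop
  have hk1 : ∀ k : ℕ, ((k : ℝ) + 1)⁻¹ ≤ 1 := fun k =>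
    inv_le_one_of_one_le₀ (by have : (0 : ℝ) ≤ k := k.cast_nonneg; linarith)
  have hk2 : ∀ k : ℕ, (1 : ℝ) ≤ (k : ℝ) + 1 := fun k => by
    have : (0 : ℝ) ≤ k := k.cast_nonneg
    linarith
  have hlogP : Tendsto (fun k => ∫ x, Real.log (u k x) ∂P) atTop (𝓝 (∫ x, llr P Q x ∂P)) := by
    refine tendsto_integral_of_dominated_convergence (fun x => |llr P Q x|)
      (fun k => (Real.measurable_log.comp (hum k)).aestronglyMeasurable) hint.abs ?_ ?_
    · intro k
      filter_upwards [hrpos] with x hx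
      exact Real.abs_log_max_min_le (by positivity) (hk1 k) (hk2 k) hx
    · filter_upwards [hrpos] with x hx
      exact (Real.continuousAt_log hx.ne').tendsto.comp (tendsto_max_inv_min_natCast hx.le)
  have hQ : Tendsto (fun k => ∫ x, u k x ∂Q) atTop (𝓝 1) := by
    have h1 : ∫ x, r x ∂Q = 1 := by
      rw [Measure.integral_toReal_rnDeriv hac]
      simp
    rw [← h1]
    refine tendsto_integral_of_dominated_convergence (fun x => 1 + r x)
      (fun k => (hum k).aestronglyMeasurable)
      ((integrable_const _).add Measure.integrable_toReal_rnDeriv) ?_ ?_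
    · refine fun k => ae_of_all _ fun x => ?_
      have h0 : 0 ≤ u k x := le_max_of_le_left (by positivity)
      rw [Real.norm_of_nonneg h0]
      refine max_le ?_ ((min_le_right _ _).trans ?_)
      · linarith [hk1 k, hr0 x]
      · linarith
    · exact ae_of_all _ fun x => tendsto_max_inv_min_natCast (hr0 x)
  have hlogQ : Tendsto (fun k => Real.log (∫ x, u k x ∂Q)) atTop (𝓝 0) := by
    have := (Real.continuousAt_log one_ne_zero).tendsto.comp hQ
    rwa [Real.log_one] at this
  have hlim := hlogP.sub hlogQ
  rw [sub_zero] at hlim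
  obtain ⟨k, hk⟩ := (hlim.eventually (lt_mem_nhds hc)).exists
  refine ⟨u k, ((k : ℝ) + 1)⁻¹, (k : ℝ) + 1, by positivity, hum k, fun x => le_max_left _ _,
    fun x => max_le ((hk1 k).trans (hk2 k)) (min_le_left _ _), hk⟩

lemma le_integral_of_forall_le {X : Type*} [MeasurableSpace X] {μ : Measure X}
    [IsProbabilityMeasure μ] {f : X → ℝ} (hf : Integrable f μ) {m : ℝ} (h : ∀ x, m ≤ f x) :
    m ≤ ∫ x, f x ∂μ := by
  simpa using integral_mono (integrable_const m) hf h

/-- The Donsker-Varadhan lower bound with bounded continuous test functions. -/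
lemma exists_boundedContinuous_lt_integral_sub_log_integral_exp {X : Type*} [MeasurableSpace X]
    [TopologicalSpace X] [TopologicalSpace.PseudoMetrizableSpace X] [BorelSpace X]
    {P Q : Measure X} [IsProbabilityMeasure P] [IsProbabilityMeasure Q] (hac : P ≪ Q)
    (hint : Integrable (llr P Q) P) {c : ℝ} (hc : c < ∫ x, llr P Q x ∂P) :
    ∃ f : BoundedContinuousFunction X ℝ,
      c < ∫ x, f x ∂P - Real.log (∫ x, Real.exp (f x) ∂Q) := by
  obtain ⟨u, m, b, hm, hum, hmu, hub, hcu⟩ :=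
    exists_measurable_lt_integral_log_sub_log_integral hac hint hc
  set δ := ∫ x, Real.log (u x) ∂P - Real.log (∫ x, u x ∂Q) - c with hδ
  have hδ0 : 0 < δ := sub_pos.2 hcu
  have hui : ∀ (μ : Measure X) [IsFiniteMeasure μ], Integrable u μ := fun μ _ =>
    Integrable.of_mem_Icc m b hum.aemeasurable (ae_of_all _ fun x => ⟨hmu x, hub x⟩)
  obtain ⟨g, hg, -⟩ := (hui (P + Q)).exists_boundedContinuous_integral_sub_le
    (ε := m * δ / 3) (by positivity)
  set v : X → ℝ := fun x => max m (g x) with hv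
  have hvc : Continuous v := by fun_prop
  have hmv : ∀ x, m ≤ v x := fun x => le_max_left _ _
  have hvpos : ∀ x, 0 < v x := fun x => hm.trans_le (hmv x)
  have hvb : ∀ x, v x ≤ max m ‖g‖ := fun x =>
    max_le_max le_rfl ((le_abs_self _).trans (g.norm_coe_le_norm x))
  have hvi : ∀ (μ : Measure X) [IsFiniteMeasure μ], Integrable v μ := fun μ _ =>
    Integrable.of_mem_Icc m _ hvc.measurable.aemeasurable (ae_of_all _ fun x => ⟨hmv x, hvb x⟩)
  have huv : ∀ x, |u x - v x| ≤ ‖u x - g x‖ := fun x => by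
    have h := abs_max_sub_max_le_abs (u x) (g x) m
    rwa [max_eq_left (hmu x), max_comm (g x)] at h
  have hgi : ∀ (μ : Measure X) [IsFiniteMeasure μ], Integrable (fun x => ‖u x - g x‖) μ :=
    fun μ _ => ((hui μ).sub (g.integrable μ)).norm
  have hle : ∀ (μ : Measure X) [IsFiniteMeasure μ], μ ≤ P + Q →
      ∫ x, |u x - v x| ∂μ ≤ m * δ / 3 := fun μ _ hμ =>
    calc ∫ x, |u x - v x| ∂μ ≤ ∫ x, ‖u x - g x‖ ∂μ :=
          integral_mono ((hui μ).sub (hvi μ)).abs (hgi μ) huv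
      _ ≤ ∫ x, ‖u x - g x‖ ∂(P + Q) :=
          integral_mono_measure hμ (ae_of_all _ fun x => norm_nonneg _) (hgi _)
      _ ≤ m * δ / 3 := hg
  have hlogm : ∀ {w : X → ℝ} {B : ℝ}, Measurable w → (∀ x, m ≤ w x) → (∀ x, w x ≤ B) →
      Integrable (fun x => Real.log (w x)) P := fun {w B} hw h1 h2 =>
    Integrable.of_mem_Icc (Real.log m) (Real.log B) (Real.measurable_log.comp hw).aemeasurable
      (ae_of_all _ fun x => ⟨Real.log_le_log hm (h1 x),
        Real.log_le_log (hm.trans_le (h1 x)) (h2 x)⟩)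
  have hlogu := hlogm hum hmu hub
  have hlogv := hlogm hvc.measurable hmv hvb
  have hP : |∫ x, Real.log (u x) ∂P - ∫ x, Real.log (v x) ∂P| ≤ δ / 3 := by
    rw [← integral_sub hlogu hlogv]
    calc |∫ x, (Real.log (u x) - Real.log (v x)) ∂P|
        ≤ ∫ x, |Real.log (u x) - Real.log (v x)| ∂P := abs_integral_le_integral_abs
      _ ≤ ∫ x, m⁻¹ * |u x - v x| ∂P :=
          integral_mono (hlogu.sub hlogv).abs (((hui P).sub (hvi P)).abs.const_mul _)
            fun x => Real.abs_log_sub_log_le hm (hmu x) (hmv x)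
      _ = m⁻¹ * ∫ x, |u x - v x| ∂P := integral_const_mul _ _
      _ ≤ m⁻¹ * (m * δ / 3) := by gcongr; exact hle P (Measure.le_add_right le_rfl)
      _ = δ / 3 := by field_simp
  have hQ : |Real.log (∫ x, u x ∂Q) - Real.log (∫ x, v x ∂Q)| ≤ δ / 3 := by
    calc |Real.log (∫ x, u x ∂Q) - Real.log (∫ x, v x ∂Q)|
        ≤ m⁻¹ * |∫ x, u x ∂Q - ∫ x, v x ∂Q| :=
          Real.abs_log_sub_log_le hm (le_integral_of_forall_le (hui Q) hmu)
            (le_integral_of_forall_le (hvi Q) hmv)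
      _ ≤ m⁻¹ * (m * δ / 3) := by
          gcongr
          rw [← integral_sub (hui Q) (hvi Q)]
          exact abs_integral_le_integral_abs.trans (hle Q (Measure.le_add_left le_rfl))
      _ = δ / 3 := by field_simp
  have hlogc : Continuous fun x => Real.log (v x) := hvc.log fun x => (hvpos x).ne'
  refine ⟨BoundedContinuousFunction.ofNormedAddCommGroup (fun x => Real.log (v x)) hlogc
    (max |Real.log m| |Real.log (max m ‖g‖)|) fun x => ?_, ?_⟩
  · exact abs_le_max_abs_abs (Real.log_le_log hm (hmv x)) (Real.log_le_log (hvpos x) (hvb x))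
  · have hexp : ∀ x, Real.exp (Real.log (v x)) = v x := fun x => Real.exp_log (hvpos x)
    simp only [BoundedContinuousFunction.coe_ofNormedAddCommGroup, hexp]
    have h1 := (abs_le.1 hP).2
    have h2 := (abs_le.1 hQ).1
    linarith

lemma integral_empMeas {X : Type*} [MeasurableSpace X] [Nonempty X] {n : ℕ} (hn : 0 < n)
    (x : Fin n → X) {f : X → ℝ} (hf : StronglyMeasurable f) :
    ∫ y, f y ∂(empMeas n x : Measure X) = (n : ℝ)⁻¹ * ∑ i, f (x i) := by
  have h : (empMeas n x : Measure X) = (n : ℝ≥0∞)⁻¹ • ∑ i, Measure.dirac (x i) := by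
    simp [empMeas, hn]
  rw [h, integral_smul_measure, integral_finsetSum_measure]
  · simp [integral_dirac' _ _ hf]
  · intro i _
    exact integrable_dirac' hf (by simp)

/-- Chernoff's bound for the empirical mean of an i.i.d. sample. -/
lemma measure_pi_lt_integral_empMeas_le {X : Type*} [MeasurableSpace X] [Nonempty X]
    (Q : Measure X) [IsProbabilityMeasure Q] {n : ℕ} (hn : 0 < n) {f : X → ℝ}
    (hf : StronglyMeasurable f) (hexp : Integrable (fun x => Real.exp (f x)) Q) (a : ℝ) :
    Measure.pi (fun _ : Fin n => Q) {x | a < ∫ y, f y ∂(empMeas n x : Measure X)} ≤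
      ENNReal.ofReal (Real.exp (n * (Real.log (∫ x, Real.exp (f x) ∂Q) - a))) := by
  set μ := Measure.pi (fun _ : Fin n => Q)
  set I := ∫ x, Real.exp (f x) ∂Q with hI
  have hIpos : 0 < I := integral_exp_pos hexp
  have hn' : (0 : ℝ) < n := by exact_mod_cast hn
  have hint : Integrable (fun x : Fin n → X => ∏ i, Real.exp (f (x i))) μ :=
    Integrable.fintype_prod (fun _ => hexp)
  have hmarkov := mul_meas_ge_le_integral_of_nonneg (μ := μ)
    (f := fun x : Fin n → X => ∏ i, Real.exp (f (x i)))
    (ae_of_all _ fun x => Finset.prod_nonneg fun i _ => (Real.exp_pos _).le) hint (Real.exp (n * a))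
  have hpow : ∫ x, ∏ i, Real.exp (f (x i)) ∂μ = I ^ n := by
    have := integral_fintype_prod_eq_pow (ι := Fin n) (μ := Q) (fun x => Real.exp (f x))
    simpa using this
  rw [hpow] at hmarkov
  have hsub : {x : Fin n → X | a < ∫ y, f y ∂(empMeas n x : Measure X)} ⊆
      {x | Real.exp (n * a) ≤ ∏ i, Real.exp (f (x i))} := by
    intro x hx
    simp only [Set.mem_ofPred_eq, integral_empMeas hn x hf] at hx
    rw [Set.mem_ofPred_eq, ← Real.exp_sum, Real.exp_le_exp]
    rw [inv_mul_eq_div, lt_div_iff₀ hn'] at hx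
    linarith
  have hreal : μ.real {x | Real.exp (n * a) ≤ ∏ i, Real.exp (f (x i))} ≤
      Real.exp (n * (Real.log I - a)) := by
    have h : Real.exp (n * (Real.log I - a)) = I ^ n / Real.exp (n * a) := by
      rw [mul_sub, Real.exp_sub, ← Real.log_pow, Real.exp_log (by positivity)]
    rw [h, le_div_iff₀ (Real.exp_pos _), mul_comm]
    exact hmarkov
  calc μ {x | a < ∫ y, f y ∂(empMeas n x : Measure X)}
      ≤ μ {x | Real.exp (n * a) ≤ ∏ i, Real.exp (f (x i))} := measure_mono hsub
    _ = ENNReal.ofReal (μ.real {x | Real.exp (n * a) ≤ ∏ i, Real.exp (f (x i))}) := by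
        rw [ofReal_measureReal]
    _ ≤ _ := ENNReal.ofReal_le_ofReal hreal

lemma le_expRate_of_le_exp {n : ℕ} (hn : 0 < n) {p : ℝ≥0∞} {c : ℝ}
    (h : p ≤ ENNReal.ofReal (Real.exp (n * -c))) : (c : EReal) ≤ expRate n p := by
  have hlog : ENNReal.log p ≤ ((n * -c : ℝ) : EReal) := by
    refine (ENNReal.log_monotone h).trans_eq ?_
    rw [ENNReal.log_ofReal_of_pos (Real.exp_pos _), Real.log_exp]
  have hn' : (n : ℝ) ≠ 0 := by exact_mod_cast hn.ne'
  rw [expRate, EReal.le_neg, ← EReal.coe_neg]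
  calc (((n : ℝ)⁻¹ : ℝ) : EReal) * ENNReal.log p
      ≤ (((n : ℝ)⁻¹ : ℝ) : EReal) * ((n * -c : ℝ) : EReal) :=
        mul_le_mul_of_nonneg_left hlog (by exact_mod_cast inv_nonneg.2 n.cast_nonneg)
    _ = ((-c : ℝ) : EReal) := by
        rw [← EReal.coe_mul, inv_mul_cancel_left₀ hn']

/-- For any metric `d` on the probability measures over a Polish space that metrizes the
topology of weak convergence, any `P, Q` with `0 < D(P‖Q) < ∞`, i.i.d. samples from `Q` with
empirical measures `Q̂_n`, and any vanishing sequence of positive thresholds `γ_n`, the type-II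
error exponent satisfies `liminf -(1/n) log Prob(d(P, Q̂_n) ≤ γ_n) ≥ D(P‖Q)`. -/
theorem error_exponent_lower_bound_of_metrizing_metric {X : Type*} [MeasurableSpace X]
    [TopologicalSpace X] [PolishSpace X] [BorelSpace X] [Nonempty X]
    (d : ProbabilityMeasure X → ProbabilityMeasure X → ℝ)
    (h_nonneg : ∀ R S, 0 ≤ d R S)
    (h_sep : ∀ R S, d R S = 0 ↔ R = S)
    (h_symm : ∀ R S, d R S = d S R)
    (h_tri : ∀ R S T, d R T ≤ d R S + d S T)
    (h_metrize : ∀ s : Set (ProbabilityMeasure X),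
      IsOpen s ↔ ∀ R ∈ s, ∃ ε > 0, ∀ S, d S R < ε → S ∈ s)
    (P Q : ProbabilityMeasure X)
    (hD0 : 0 < klDiv (P : Measure X) (Q : Measure X))
    (hD1 : klDiv (P : Measure X) (Q : Measure X) < ⊤)
    (γ : ℕ → ℝ) (hγpos : ∀ n, 0 < γ n) (hγ0 : Tendsto γ atTop (𝓝 0)) :
    ((klDiv (P : Measure X) (Q : Measure X) : ℝ≥0∞) : EReal)
      ≤ liminf (fun n : ℕ => expRate n
          (Measure.pi (fun _ : Fin n => (Q : Measure X))
            {x | d P (empMeas n x) ≤ γ n})) atTop := by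
  have hfin : (P : Measure X) ≪ Q ∧ Integrable (llr (P : Measure X) Q) P := by
    by_contra h
    rw [klDiv, if_neg h] at hD1
    exact lt_irrefl _ hD1
  obtain ⟨hac, hint⟩ := hfin
  rw [klDiv, if_pos ⟨hac, hint⟩] at hD0 ⊢
  rw [EReal.coe_ennreal_ofReal, max_eq_left (ENNReal.ofReal_pos.1 hD0).le]
  refine EReal.ge_of_forall_gt_iff_ge.1 fun c hc => ?_
  obtain ⟨f, hf⟩ := exists_boundedContinuous_lt_integral_sub_log_integral_exp hac hint
    (EReal.coe_lt_coe_iff.1 hc)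
  set L := Real.log (∫ x, Real.exp (f x) ∂(Q : Measure X)) with hL
  have hopen : IsOpen {R : ProbabilityMeasure X | c + L < ∫ x, f x ∂(R : Measure X)} :=
    isOpen_lt continuous_const
      (ProbabilityMeasure.continuous_integral_boundedContinuousFunction f)
  obtain ⟨ε, hε, hball⟩ := (h_metrize _).1 hopen P (show c + L < _ by linarith)
  have hexp : Integrable (fun x => Real.exp (f x)) (Q : Measure X) := by
    refine Integrable.of_mem_Icc 0 (Real.exp ‖f‖)
      (Real.continuous_exp.comp f.continuous).measurable.aemeasurable (ae_of_all _ fun x => ?_)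
    exact ⟨(Real.exp_pos _).le,
      Real.exp_le_exp.2 ((le_abs_self _).trans (f.norm_coe_le_norm x))⟩
  refine le_liminf_of_le (h := ?_)
  filter_upwards [hγ0.eventually (gt_mem_nhds hε), eventually_gt_atTop 0] with n hγn hn
  refine le_expRate_of_le_exp hn ?_
  have hbound := measure_pi_lt_integral_empMeas_le (Q : Measure X) hn
    f.continuous.measurable.stronglyMeasurable hexp (c + L)
  rw [← hL, show L - (c + L) = -c by ring] at hbound
  refine (measure_mono fun x hx => ?_).trans hbound
  refine hball _ ?_
  rw [h_symm]
  exact lt_of_le_of_lt hx hγn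
end
end
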